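/- Case 15 of Theorem 1.2: the hypergeometric group Γ(f,g) generated by the companion matrices A and B of f(x) = x^5 - 3x^4 + 5x^3 - 5x^2 + 3x - 1 and g(x) = x^5 + 3x^4 + 5x^3 + 5x^2 + 3x + 1 is an arithmetic subgroup of the integral orthogonal group O_Q(ℤ): Γ(f,g) is contained in O_Q(ℤ) (in particular Aᵀ·Q·A = Q and Bᵀ·Q·B = Q), and Γ(f,g) has finite index in O_Q(ℤ). -/

import Mathlib

open Matrix

/-- The companion matrix `A` of `f(x) = x^5 - 3*x^4 + 5*x^3 - 5*x^2 + 3*x - 1`. -/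
def matA : Matrix (Fin 5) (Fin 5) ℤ :=
  !![(0 : ℤ), 0, 0, 0, 1; 1, 0, 0, 0, -3; 0, 1, 0, 0, 5; 0, 0, 1, 0, -5; 0, 0, 0, 1, 3]

/-- The companion matrix `B` of `g(x) = x^5 + 3*x^4 + 5*x^3 + 5*x^2 + 3*x + 1`. -/
def matB : Matrix (Fin 5) (Fin 5) ℤ :=
  !![(0 : ℤ), 0, 0, 0, -1; 1, 0, 0, 0, -3; 0, 1, 0, 0, -5; 0, 0, 1, 0, -5; 0, 0, 0, 1, -3]

/-- The symmetric integer matrix `Q` of the quadratic form preserved by `Γ(f,g)`. -/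
def matQ : Matrix (Fin 5) (Fin 5) ℤ :=
  !![(4 : ℤ), 0, -5, 0, 13; 0, 4, 0, -5, 0; -5, 0, 4, 0, -5; 0, -5, 0, 4, 0; 13, 0, -5, 0, 4]

/-- The integral orthogonal group `O_Q(ℤ)` of a matrix `Q`, as the subgroup of `GL₅(ℤ)`
consisting of all `M` with `Mᵀ * Q * M = Q`. -/
def orthogonalSubgroup (Q : Matrix (Fin 5) (Fin 5) ℤ) : Subgroup (GL (Fin 5) ℤ) where
  carrier := { M : GL (Fin 5) ℤ |
      (M : Matrix (Fin 5) (Fin 5) ℤ)ᵀ * Q * (M : Matrix (Fin 5) (Fin 5) ℤ) = Q }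
  one_mem' := by simp
  mul_mem' := by
    intro a b ha hb
    simp only [Set.mem_setOf_eq, Units.val_mul, transpose_mul] at ha hb ⊢
    calc ((b : Matrix (Fin 5) (Fin 5) ℤ)ᵀ * (a : Matrix (Fin 5) (Fin 5) ℤ)ᵀ) * Q *
          ((a : Matrix (Fin 5) (Fin 5) ℤ) * (b : Matrix (Fin 5) (Fin 5) ℤ))
        = (b : Matrix (Fin 5) (Fin 5) ℤ)ᵀ *
            ((a : Matrix (Fin 5) (Fin 5) ℤ)ᵀ * Q * (a : Matrix (Fin 5) (Fin 5) ℤ)) *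
            (b : Matrix (Fin 5) (Fin 5) ℤ) := by
          simp only [mul_assoc]
      _ = Q := by rw [ha, hb]
  inv_mem' := by
    intro a ha
    simp only [Set.mem_setOf_eq] at ha ⊢
    calc ((a⁻¹ : GL (Fin 5) ℤ) : Matrix (Fin 5) (Fin 5) ℤ)ᵀ * Q *
          ((a⁻¹ : GL (Fin 5) ℤ) : Matrix (Fin 5) (Fin 5) ℤ)
        = ((a⁻¹ : GL (Fin 5) ℤ) : Matrix (Fin 5) (Fin 5) ℤ)ᵀ *
            ((a : Matrix (Fin 5) (Fin 5) ℤ)ᵀ * Q * (a : Matrix (Fin 5) (Fin 5) ℤ)) *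
            ((a⁻¹ : GL (Fin 5) ℤ) : Matrix (Fin 5) (Fin 5) ℤ) := by rw [ha]
      _ = ((a : Matrix (Fin 5) (Fin 5) ℤ) *
            ((a⁻¹ : GL (Fin 5) ℤ) : Matrix (Fin 5) (Fin 5) ℤ))ᵀ * Q *
          ((a : Matrix (Fin 5) (Fin 5) ℤ) *
            ((a⁻¹ : GL (Fin 5) ℤ) : Matrix (Fin 5) (Fin 5) ℤ)) := by
          simp only [transpose_mul, mul_assoc]
      _ = Q := by rw [Units.mul_inv]; simp

/-! ### The polynomial transvections -/

/-- The image in the orthogonal group of the `k`-th power of the symplectic transvection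
along `(p, q, r, s)`. -/
def tM (p q r s k : ℤ) : Matrix (Fin 5) (Fin 5) ℤ :=
  !![1 - k*(p*q + r*s), -(k*(r*r)), 2*k*(p*r), k*(p*p), 0;
     k*(s*s), 1 + k*(r*s - p*q), -(2*k*(p*s)), 0, -(k*(p*p));
     -(k*(q*s)), -(k*(q*r)), 1, k*(p*s), -(k*(p*r));
     -(k*(q*q)), 0, 2*k*(q*r), 1 + k*(p*q - r*s), k*(r*r);
     0, k*(q*q), 2*k*(q*s), -(k*(s*s)), 1 + k*(p*q + r*s)]

/-- The image of the short root type elements. -/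
def sM (p q r s k : ℤ) : Matrix (Fin 5) (Fin 5) ℤ :=
  !![1 - k*k*(p*q*(r*s)), -(k*k*(p*q*(r*r))), 2*k*(p*r), k*k*(p*p*(r*s)), -(k*k*(p*p*(r*r)));
     k*k*(p*q*(s*s)), 1 + k*k*(p*q*(r*s)), -(2*k*(p*s)), -(k*k*(p*p*(s*s))), k*k*(p*p*(r*s));
     -(k*(q*s)), -(k*(q*r)), 1, k*(p*s), -(k*(p*r));
     -(k*k*(q*q*(r*s))), -(k*k*(q*q*(r*r))), 2*k*(q*r), 1 + k*k*(p*q*(r*s)), -(k*k*(p*q*(r*r)));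
     -(k*k*(q*q*(s*s))), -(k*k*(q*q*(r*s))), 2*k*(q*s), k*k*(p*q*(s*s)), 1 - k*k*(p*q*(r*s))]

/-- The standard form, `2 (cd + ab + s^2)`. -/
def matJ : Matrix (Fin 5) (Fin 5) ℤ :=
  !![0, 0, 0, 0, 1; 0, 0, 0, 1, 0; 0, 0, 2, 0, 0; 0, 1, 0, 0, 0; 1, 0, 0, 0, 0]

theorem tM_mul (p q r s j k : ℤ) : tM p q r s j * tM p q r s k = tM p q r s (j + k) := by
  ext i l
  fin_cases i <;> fin_cases l <;> simp [tM, Matrix.mul_apply, Fin.sum_univ_five] <;> ring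

theorem tM_zero (p q r s : ℤ) : tM p q r s 0 = 1 := by
  ext i l
  fin_cases i <;> fin_cases l <;> simp [tM]

theorem sM_mul (p q r s j k : ℤ) : sM p q r s j * sM p q r s k = sM p q r s (j + k) := by
  ext i l
  fin_cases i <;> fin_cases l <;> simp [sM, Matrix.mul_apply, Fin.sum_univ_five] <;> ring

theorem sM_zero (p q r s : ℤ) : sM p q r s 0 = 1 := by
  ext i l
  fin_cases i <;> fin_cases l <;> simp [sM]

/-- `tM` as an element of `GL₅(ℤ)`. -/
def tG (p q r s k : ℤ) : GL (Fin 5) ℤ :=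
  ⟨tM p q r s k, tM p q r s (-k), by rw [tM_mul, add_neg_cancel, tM_zero],
    by rw [tM_mul, neg_add_cancel, tM_zero]⟩

/-- `sM` as an element of `GL₅(ℤ)`. -/
def sG (p q r s k : ℤ) : GL (Fin 5) ℤ :=
  ⟨sM p q r s k, sM p q r s (-k), by rw [sM_mul, add_neg_cancel, sM_zero],
    by rw [sM_mul, neg_add_cancel, sM_zero]⟩

theorem tM_conj (p q r s p' q' r' s' j k : ℤ) :
    tM p q r s j * tM p' q' r' s' k =
      tM (p' + j*(p*q'-q*p'+r*s'-s*r')*p) (q' + j*(p*q'-q*p'+r*s'-s*r')*q)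
        (r' + j*(p*q'-q*p'+r*s'-s*r')*r) (s' + j*(p*q'-q*p'+r*s'-s*r')*s) k * tM p q r s j := by
  ext i l
  fin_cases i <;> fin_cases l <;> simp [tM, Matrix.mul_apply, Fin.sum_univ_five] <;> ring

theorem tM_split (p q r s x y n : ℤ) :
    tM (x*p) (x*q) (y*r) (y*s) n =
      tM p q 0 0 (x*x*n) * tM 0 0 r s (y*y*n) * sM p q r s (x*y*n) := by
  ext i l
  fin_cases i <;> fin_cases l <;> simp [tM, sM, Matrix.mul_apply, Fin.sum_univ_five] <;> ring

theorem sM_left (p q r s k : ℤ) :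
    sM p q r s k = sM 1 0 r s (k*p) * sM 0 1 r s (k*q) * tM 0 0 r s (-(k*k*(p*q))) := by
  ext i l
  fin_cases i <;> fin_cases l <;> simp [tM, sM, Matrix.mul_apply, Fin.sum_univ_five] <;> ring

theorem sM_right (p q r s k : ℤ) :
    sM p q r s k = sM p q 1 0 (k*r) * sM p q 0 1 (k*s) * tM p q 0 0 (-(k*k*(r*s))) := by
  ext i l
  fin_cases i <;> fin_cases l <;> simp [tM, sM, Matrix.mul_apply, Fin.sum_univ_five] <;> ring

theorem tM_orth (p q r s k : ℤ) : (tM p q r s k)ᵀ * matJ * tM p q r s k = matJ := by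
  ext i l
  fin_cases i <;> fin_cases l <;>
    simp [tM, matJ, Matrix.mul_apply, Fin.sum_univ_five, Matrix.transpose_apply] <;> ring

/-- The relations satisfied by `t` and `s` that are used in the argument. -/
structure TRel {R G : Type*} [CommRing R] [Group G] (t s : R → R → R → R → R → G) : Prop where
  add : ∀ p q r u j k, t p q r u j * t p q r u k = t p q r u (j + k)
  conj : ∀ p q r u p' q' r' u' j k,
    t p q r u j * t p' q' r' u' k =
      t (p' + j*(p*q'-q*p'+r*u'-u*r')*p) (q' + j*(p*q'-q*p'+r*u'-u*r')*q)
        (r' + j*(p*q'-q*p'+r*u'-u*r')*r) (u' + j*(p*q'-q*p'+r*u'-u*r')*u) k * t p q r u j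
  split : ∀ p q r u x y n, t (x*p) (x*q) (y*r) (y*u) n =
      t p q 0 0 (x*x*n) * t 0 0 r u (y*y*n) * s p q r u (x*y*n)
  left : ∀ p q r u k,
    s p q r u k = s 1 0 r u (k*p) * s 0 1 r u (k*q) * t 0 0 r u (-(k*k*(p*q)))
  right : ∀ p q r u k,
    s p q r u k = s p q 1 0 (k*r) * s p q 0 1 (k*u) * t p q 0 0 (-(k*k*(r*u)))

theorem trel_GL : TRel tG sG where
  add p q r u j k := Units.ext (tM_mul p q r u j k)
  conj p q r u p' q' r' u' j k := Units.ext (tM_conj p q r u p' q' r' u' j k)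
  split p q r u x y n := Units.ext (tM_split p q r u x y n)
  left p q r u k := Units.ext (sM_left p q r u k)
  right p q r u k := Units.ext (sM_right p q r u k)

theorem TRel.map {R G G' : Type*} [CommRing R] [Group G] [Group G'] {t s : R → R → R → R → R → G}
    (h : TRel t s) (f : G →* G') :
    TRel (fun p q r u k => f (t p q r u k)) (fun p q r u k => f (s p q r u k)) where
  add p q r u j k := by rw [← map_mul, h.add]
  conj p q r u p' q' r' u' j k := by rw [← map_mul, h.conj, map_mul]
  split p q r u x y n := by rw [h.split, map_mul, map_mul]
  left p q r u k := by rw [h.left, map_mul, map_mul]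
  right p q r u k := by rw [h.right, map_mul, map_mul]

theorem TRel.pi {R G : Type*} [CommRing R] [Group G] {t s : R → R → R → R → R → G}
    (h : TRel t s) (ι : Type*) :
    TRel (R := ι → R) (G := ι → G) (fun p q r u k i => t (p i) (q i) (r i) (u i) (k i))
      (fun p q r u k i => s (p i) (q i) (r i) (u i) (k i)) where
  add p q r u j k := by funext i; exact h.add _ _ _ _ _ _
  conj p q r u p' q' r' u' j k := by funext i; exact h.conj _ _ _ _ _ _ _ _ _ _
  split p q r u x y n := by funext i; exact h.split _ _ _ _ _ _ _
  left p q r u k := by funext i; exact h.left _ _ _ _ _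
  right p q r u k := by funext i; exact h.right _ _ _ _ _

section word
variable {R G : Type*} [CommRing R] [Group G] {t s : R → R → R → R → R → G}

theorem TRel.s_eq (h : TRel t s) (p q r u n : R) :
    s p q r u n = (t p q 0 0 n * t 0 0 r u n)⁻¹ * t p q r u n := by
  have := h.split p q r u 1 1 n
  simp only [one_mul] at this
  rw [this]; group

theorem TRel.t_zero (h : TRel t s) (p q r u : R) : t p q r u 0 = 1 := by
  have := h.add p q r u 0 0
  simpa using this

theorem TRel.t_neg (h : TRel t s) (p q r u n : R) : t p q r u (-n) = (t p q r u n)⁻¹ := by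
  rw [eq_inv_iff_mul_eq_one, h.add, neg_add_cancel, h.t_zero]

theorem TRel.conj' (h : TRel t s) (p q r u p' q' r' u' j k : R) :
    t p q r u j * t p' q' r' u' k * (t p q r u j)⁻¹ =
      t (p' + j*(p*q'-q*p'+r*u'-u*r')*p) (q' + j*(p*q'-q*p'+r*u'-u*r')*q)
        (r' + j*(p*q'-q*p'+r*u'-u*r')*r) (u' + j*(p*q'-q*p'+r*u'-u*r')*u) k := by
  rw [h.conj]; group

theorem TRel.conj1 (h : TRel t s) (p q n m : R) :
    s p q 0 1 n * t 0 0 1 0 m * (s p q 0 1 n)⁻¹ = t (-n*p) (-n*q) 1 0 m := by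
  have e : s p q 0 1 n = t 0 0 0 1 (-n) * (t p q 0 0 (-n) * t p q 0 1 n) := by
    rw [h.s_eq, h.t_neg, h.t_neg]; group
  have e1 := h.conj' p q 0 1 0 0 1 0 n m
  have e2 := h.conj' p q 0 0 (-n*p) (-n*q) 1 (-n) (-n) m
  have e3 := h.conj' 0 0 0 1 (-n*p) (-n*q) 1 (-n) (-n) m
  ring_nf at e1 e2 e3
  rw [e]
  calc _ = t 0 0 0 1 (-n) * (t p q 0 0 (-n) * (t p q 0 1 n * t 0 0 1 0 m * (t p q 0 1 n)⁻¹) *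
        (t p q 0 0 (-n))⁻¹) * (t 0 0 0 1 (-n))⁻¹ := by group
    _ = _ := by ring_nf; rw [e1, e2, e3]

theorem TRel.conj2 (h : TRel t s) (p q n m : R) :
    s 0 1 p q n * t 1 0 0 0 m * (s 0 1 p q n)⁻¹ = t 1 0 (-n*p) (-n*q) m := by
  have e : s 0 1 p q n = t 0 0 p q (-n) * (t 0 1 0 0 (-n) * t 0 1 p q n) := by
    rw [h.s_eq, h.t_neg, h.t_neg]; group
  have e1 := h.conj' 0 1 p q 1 0 0 0 n m
  have e2 := h.conj' 0 1 0 0 1 (-n) (-n*p) (-n*q) (-n) m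
  have e3 := h.conj' 0 0 p q 1 0 (-n*p) (-n*q) (-n) m
  ring_nf at e1 e2 e3
  rw [e]
  calc _ = t 0 0 p q (-n) * (t 0 1 0 0 (-n) * (t 0 1 p q n * t 1 0 0 0 m * (t 0 1 p q n)⁻¹) *
        (t 0 1 0 0 (-n))⁻¹) * (t 0 0 p q (-n))⁻¹ := by group
    _ = _ := by ring_nf; rw [e1, e2, e3]

theorem TRel.word (h : TRel t s) (K : Subgroup G) (k : R)
    (h1 : ∀ c, t 1 0 0 0 (k*c) ∈ K) (h2 : ∀ c, t 0 1 0 0 (k*c) ∈ K)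
    (h3 : ∀ c, t 0 0 1 0 (k*c) ∈ K) (h4 : ∀ c, t 0 0 0 1 (k*c) ∈ K)
    (h13 : ∀ c, t 1 0 1 0 (k*c) ∈ K) (h14 : ∀ c, t 1 0 0 1 (k*c) ∈ K)
    (h23 : ∀ c, t 0 1 1 0 (k*c) ∈ K) (h24 : ∀ c, t 0 1 0 1 (k*c) ∈ K) (p q r u c : R) :
    t p q r u (k*k*k*c) ∈ K := by
  have s13 : ∀ c, s 1 0 1 0 (k*c) ∈ K := fun c => by
    rw [h.s_eq]; exact K.mul_mem (K.inv_mem (K.mul_mem (h1 c) (h3 c))) (h13 c)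
  have s14 : ∀ c, s 1 0 0 1 (k*c) ∈ K := fun c => by
    rw [h.s_eq]; exact K.mul_mem (K.inv_mem (K.mul_mem (h1 c) (h4 c))) (h14 c)
  have s23 : ∀ c, s 0 1 1 0 (k*c) ∈ K := fun c => by
    rw [h.s_eq]; exact K.mul_mem (K.inv_mem (K.mul_mem (h2 c) (h3 c))) (h23 c)
  have s24 : ∀ c, s 0 1 0 1 (k*c) ∈ K := fun c => by
    rw [h.s_eq]; exact K.mul_mem (K.inv_mem (K.mul_mem (h2 c) (h4 c))) (h24 c)
  have key : ∀ {a b d e f x : R}, (∀ c, t a b d e (k*c) ∈ K) → k*f = x → t a b d e x ∈ K := by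
    intro a b d e f x H hx; rw [← hx]; exact H f
  have key' : ∀ {a b d e f x : R}, (∀ c, s a b d e (k*c) ∈ K) → k*f = x → s a b d e x ∈ K := by
    intro a b d e f x H hx; rw [← hx]; exact H f
  have sl3 : ∀ p q c, s p q 1 0 (k*c) ∈ K := fun p q c => by
    rw [h.left]
    exact K.mul_mem (K.mul_mem (key' (f := c*p) s13 (by ring)) (key' (f := c*q) s23 (by ring)))
      (key (f := -(c*k*c*(p*q))) h3 (by ring))
  have sl4 : ∀ p q c, s p q 0 1 (k*c) ∈ K := fun p q c => by
    rw [h.left]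
    exact K.mul_mem (K.mul_mem (key' (f := c*p) s14 (by ring)) (key' (f := c*q) s24 (by ring)))
      (key (f := -(c*k*c*(p*q))) h4 (by ring))
  have sr1 : ∀ p q c, s 1 0 p q (k*c) ∈ K := fun p q c => by
    rw [h.right]
    exact K.mul_mem (K.mul_mem (key' (f := c*p) s13 (by ring)) (key' (f := c*q) s14 (by ring)))
      (key (f := -(c*k*c*(p*q))) h1 (by ring))
  have sr2 : ∀ p q c, s 0 1 p q (k*c) ∈ K := fun p q c => by
    rw [h.right]
    exact K.mul_mem (K.mul_mem (key' (f := c*p) s23 (by ring)) (key' (f := c*q) s24 (by ring)))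
      (key (f := -(c*k*c*(p*q))) h2 (by ring))
  have tl : ∀ p q c, t p q 0 0 (k*(k*k*c)) ∈ K := fun p q c => by
    have e := h.conj1 p q k (k*c)
    have m1 : t (-k*p) (-k*q) 1 0 (k*c) ∈ K := by
      rw [← e]
      have := key' (f := 1) (sl4 p q) (mul_one k)
      exact K.mul_mem (K.mul_mem this (h3 c)) (K.inv_mem this)
    have e2 := h.split p q 1 0 (-k) 1 (k*c)
    rw [mul_one, mul_zero, ← mul_inv_eq_iff_eq_mul, ← mul_inv_eq_iff_eq_mul] at e2
    have : (-k*-k*(k*c)) = k*(k*k*c) := by ring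
    rw [this] at e2
    rw [← e2]
    exact K.mul_mem (K.mul_mem m1 (K.inv_mem (key' (f := -k*c) (sl3 p q) (by ring))))
      (K.inv_mem (key (f := c) h3 (by ring)))
  have tr : ∀ p q c, t 0 0 p q (k*(k*k*c)) ∈ K := fun p q c => by
    have e := h.conj2 p q k (k*c)
    have m1 : t 1 0 (-k*p) (-k*q) (k*c) ∈ K := by
      rw [← e]
      have := key' (f := 1) (sr2 p q) (mul_one k)
      exact K.mul_mem (K.mul_mem this (h1 c)) (K.inv_mem this)
    have e2 := h.split 1 0 p q 1 (-k) (k*c)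
    rw [mul_one, mul_zero, ← mul_inv_eq_iff_eq_mul, ← inv_mul_eq_iff_eq_mul] at e2
    have : (-k*-k*(k*c)) = k*(k*k*c) := by ring
    rw [this] at e2
    rw [← e2]
    exact K.mul_mem (K.inv_mem (key (f := c) h1 (by ring))) (K.mul_mem m1
      (K.inv_mem (key' (f := -k*c) (sr1 p q) (by ring))))
  have e := h.split p q r u 1 1 (k*(k*k*c))
  simp only [one_mul] at e
  have e0 : k*k*k*c = k*(k*k*c) := by ring
  rw [e0, e, h.left]
  refine K.mul_mem (K.mul_mem (tl _ _ _) (tr _ _ _)) (K.mul_mem (K.mul_mem ?_ ?_) ?_)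
  · exact key' (f := k*k*c*p) (sr1 r u) (by ring)
  · exact key' (f := k*k*c*q) (sr2 r u) (by ring)
  · have : -(k * (k * k * c) * (k * (k * k * c)) * (p * q)) =
      k*(k*k*(-(c* (k * (k * k * c)) * (p * q)))) := by ring
    rw [this]; exact tr _ _ _
end word

section finite_quotient

theorem finite_of_conj_closed {G : Type*} [Group G] (S : Set G) (hfin : S.Finite)
    (hcl : Subgroup.closure S = ⊤) (hconj : ∀ g x, x ∈ S → g * x * g⁻¹ ∈ S)
    (htor : ∀ x ∈ S, IsOfFinOrder x) : Finite G := by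
  have : Finite S := hfin
  let φ : G →* Equiv.Perm S :=
    { toFun := fun g =>
        { toFun := fun x => ⟨g * x * g⁻¹, hconj g x x.2⟩
          invFun := fun x => ⟨g⁻¹ * x * g, by simpa using hconj g⁻¹ x x.2⟩
          left_inv := fun x => by ext; simp [mul_assoc]
          right_inv := fun x => by ext; simp [mul_assoc] }
      map_one' := by ext x; simp
      map_mul' := fun a b => by ext x; simp [mul_assoc] }
  have hker : φ.ker ≤ Subgroup.center G := by
    intro g hg
    rw [Subgroup.mem_center_iff]
    have hx : ∀ x ∈ S, x ∈ Subgroup.centralizer {g} := by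
      intro x hx
      rw [Subgroup.mem_centralizer_singleton_iff]
      have h1 : (φ g) ⟨x, hx⟩ = ⟨x, hx⟩ := by rw [MonoidHom.mem_ker.1 hg]; rfl
      have h2 : g * x * g⁻¹ = x := congrArg Subtype.val h1
      rw [mul_inv_eq_iff_eq_mul] at h2
      first | exact h2 | exact h2.symm
    have hle : Subgroup.closure S ≤ Subgroup.centralizer {g} := (Subgroup.closure_le _).2 hx
    rw [hcl] at hle
    intro y
    have := hle (Subgroup.mem_top y)
    rw [Subgroup.mem_centralizer_singleton_iff] at this
    first | exact this | exact this.symm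
  have hfi : (Subgroup.center G).FiniteIndex := Subgroup.finiteIndex_of_le hker
  have hfg : Group.FG G := Group.fg_iff.2 ⟨S, hcl, hfin⟩
  letI : CommGroup (Subgroup.center G) :=
    { (Subgroup.center G).toGroup with mul_comm := fun a b => mul_comm' a b }
  let T : Subgroup G := (CommGroup.torsion (Subgroup.center G)).comap
    (MonoidHom.transferCenterPow G)
  have hT : T = ⊤ := by
    rw [eq_top_iff, ← hcl, Subgroup.closure_le]
    intro x hx
    change IsOfFinOrder (MonoidHom.transferCenterPow G x)
    exact MonoidHom.isOfFinOrder _ (htor x hx)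
  have htors : IsMulTorsion (Subgroup.center G) := by
    intro z
    have h1 : (z : G) ∈ T := by rw [hT]; trivial
    have h2 : IsOfFinOrder (MonoidHom.transferCenterPow G (z : G)) := h1
    have h3 : MonoidHom.transferCenterPow G (z : G) = z ^ (Subgroup.center G).index := by
      ext; simp
    rw [h3] at h2
    exact h2.of_pow hfi.index_ne_zero
  have hfgZ : Group.FG (Subgroup.center G) := inferInstance
  have : Finite (Subgroup.center G) := CommGroup.finite_of_fg_isMulTorsion _ htors
  have hfq : Finite (G ⧸ Subgroup.center G) := inferInstance
  exact Finite.of_equiv _ (Subgroup.groupEquivQuotientProdSubgroup (s := Subgroup.center G)).symm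

/-- Functions with finite range. -/
def finRange (ι G : Type*) [Group G] : Subgroup (ι → G) where
  carrier := {f | (Set.range f).Finite}
  one_mem' := (Set.finite_singleton (1 : G)).subset (by rintro _ ⟨i, rfl⟩; rfl)
  mul_mem' := by
    intro f g hf hg
    refine (hf.mul hg).subset ?_
    rintro _ ⟨i, rfl⟩
    exact Set.mul_mem_mul ⟨i, rfl⟩ ⟨i, rfl⟩
  inv_mem' := by
    intro f hf
    refine (hf.image (fun x => x⁻¹)).subset ?_
    rintro _ ⟨i, rfl⟩
    exact ⟨f i, ⟨i, rfl⟩, rfl⟩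

variable {G : Type*} [Group G] {t s : ℤ → ℤ → ℤ → ℤ → ℤ → G}

theorem TRel.t_pow (h : TRel t s) (p q r u n : ℤ) (k : ℕ) :
    t p q r u n ^ k = t p q r u (k * n) := by
  induction k with
  | zero => simp [h.t_zero]
  | succ k ih => rw [pow_succ, ih, h.add]; congr 1; push_cast; ring

theorem TRel.t_zpow (h : TRel t s) (p q r u n k : ℤ) :
    t p q r u n ^ k = t p q r u (k * n) := by
  obtain ⟨j, rfl | rfl⟩ := k.eq_nat_or_neg
  · rw [zpow_natCast, h.t_pow]
  · rw [_root_.zpow_neg, zpow_natCast, h.t_pow, ← h.t_neg]; congr 1; ring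

theorem TRel.finite_set (h : TRel t s) (m : ℤ) (hm : 0 < m)
    (hk : ∀ p q r u, t p q r u m = 1) :
    {x | ∃ p q r u, x = t p q r u 1}.Finite := by
  have hmod : ∀ p q r u c, t p q r u c = t p q r u (c % m) := by
    intro p q r u c
    conv_lhs => rw [← Int.emod_add_mul_ediv c m, ← h.add, mul_comm m, ← h.t_zpow, hk]
    simp
  have hfin : ∀ p q r u, (Set.range (t p q r u)).Finite := by
    intro p q r u
    refine ((Set.finite_Ico (0:ℤ) m).image (t p q r u)).subset ?_
    rintro _ ⟨c, rfl⟩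
    exact ⟨c % m, ⟨Int.emod_nonneg _ hm.ne', Int.emod_lt_of_pos _ hm⟩, (hmod _ _ _ _ _).symm⟩
  have hc : ∀ p q r u : ℤ, ∀ c : (ℤ × ℤ × ℤ × ℤ) → ℤ,
      (fun i => t p q r u ((1 * c) i)) ∈ finRange (ℤ × ℤ × ℤ × ℤ) G := by
    intro p q r u c
    refine (hfin p q r u).subset ?_
    rintro _ ⟨i, rfl⟩
    exact ⟨_, rfl⟩
  have := (h.pi (ℤ × ℤ × ℤ × ℤ)).word (finRange _ G) 1
    (hc 1 0 0 0) (hc 0 1 0 0) (hc 0 0 1 0) (hc 0 0 0 1)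
    (hc 1 0 1 0) (hc 1 0 0 1) (hc 0 1 1 0) (hc 0 1 0 1)
    (fun v => v.1) (fun v => v.2.1) (fun v => v.2.2.1) (fun v => v.2.2.2) 1
  refine Set.Finite.subset this ?_
  rintro _ ⟨p, q, r, u, rfl⟩
  exact ⟨(p, q, r, u), by simp⟩

theorem TRel.finiteIndex_top (h : TRel t s)
    (htop : Subgroup.closure {x | ∃ p q r u, x = t p q r u 1} = ⊤) (m : ℤ) (hm : 0 < m) :
    (Subgroup.closure {x | ∃ p q r u, x = t p q r u m}).FiniteIndex := by
  have hconj : ∀ (n : ℤ) (g x : G), x ∈ {x | ∃ p q r u, x = t p q r u n} →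
      g * x * g⁻¹ ∈ {x | ∃ p q r u, x = t p q r u n} := by
    intro n g
    have hg : g ∈ Subgroup.closure {x | ∃ p q r u, x = t p q r u 1} := by rw [htop]; trivial
    induction hg using Subgroup.closure_induction'' with
    | one => intro x hx; simpa using hx
    | mem y hy =>
      obtain ⟨p, q, r, u, rfl⟩ := hy
      rintro x ⟨p', q', r', u', rfl⟩
      exact ⟨_, _, _, _, h.conj' _ _ _ _ _ _ _ _ _ _⟩
    | inv_mem y hy =>
      obtain ⟨p, q, r, u, rfl⟩ := hy
      rintro x ⟨p', q', r', u', rfl⟩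
      rw [← h.t_neg]
      exact ⟨_, _, _, _, h.conj' _ _ _ _ _ _ _ _ _ _⟩
    | mul a b _ _ ha hb =>
      intro x hx
      have := ha _ (hb x hx)
      simpa [mul_assoc] using this
  set N := Subgroup.normalClosure {x | ∃ p q r u, x = t p q r u m} with hN
  have hle : N ≤ Subgroup.closure {x | ∃ p q r u, x = t p q r u m} := by
    refine Subgroup.closure_mono ?_
    intro x hx
    obtain ⟨y, hy, hyx⟩ := Group.mem_conjugatesOfSet_iff.1 hx
    obtain ⟨g, rfl⟩ := isConj_iff.1 hyx
    exact hconj m g y hy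
  have hq := h.map (QuotientGroup.mk' N)
  have hone : ∀ p q r u, QuotientGroup.mk' N (t p q r u m) = 1 := by
    intro p q r u
    rw [← MonoidHom.mem_ker, QuotientGroup.ker_mk']
    exact Subgroup.subset_normalClosure ⟨p, q, r, u, rfl⟩
  have hF : Finite (G ⧸ N) := by
    refine finite_of_conj_closed {x | ∃ p q r u, x = QuotientGroup.mk' N (t p q r u 1)}
      (hq.finite_set m hm hone) ?_ ?_ ?_
    · have := congrArg (Subgroup.map (QuotientGroup.mk' N)) htop
      rw [MonoidHom.map_closure, ← MonoidHom.range_eq_map,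
        MonoidHom.range_eq_top.2 (QuotientGroup.mk'_surjective N)] at this
      rw [← this]
      congr 1
      ext x
      constructor
      · rintro ⟨p, q, r, u, rfl⟩
        exact ⟨_, ⟨p, q, r, u, rfl⟩, rfl⟩
      · rintro ⟨_, ⟨p, q, r, u, rfl⟩, rfl⟩
        exact ⟨p, q, r, u, rfl⟩
    · rintro g x ⟨p, q, r, u, rfl⟩
      obtain ⟨g, rfl⟩ := QuotientGroup.mk'_surjective N g
      obtain ⟨p', q', r', u', h'⟩ := hconj 1 g _ ⟨p, q, r, u, rfl⟩
      exact ⟨p', q', r', u', by rw [← h', map_mul, map_mul, map_inv]⟩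
    · rintro x ⟨p, q, r, u, rfl⟩
      rw [isOfFinOrder_iff_zpow_eq_one]
      refine ⟨m, hm.ne', ?_⟩
      rw [← map_zpow, h.t_zpow, mul_one, hone]
  have : N.FiniteIndex := Subgroup.finiteIndex_of_finite_quotient
  exact Subgroup.finiteIndex_of_le hle

theorem TRel.relIndex (h : TRel t s) (m : ℤ) (hm : 0 < m) :
    (Subgroup.closure {x | ∃ p q r u, x = t p q r u m}).relIndex
      (Subgroup.closure {x | ∃ p q r u, x = t p q r u 1}) ≠ 0 := by
  set H := Subgroup.closure {x | ∃ p q r u, x = t p q r u 1} with hH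
  have h1 : ∀ p q r u, t p q r u 1 ∈ H := fun p q r u => Subgroup.subset_closure ⟨p, q, r, u, rfl⟩
  have ht : ∀ p q r u n, t p q r u n ∈ H := fun p q r u n => by
    have := h.t_zpow p q r u 1 n
    rw [mul_one] at this
    rw [← this]; exact H.zpow_mem (h1 _ _ _ _) n
  have hs : ∀ p q r u n, s p q r u n ∈ H := fun p q r u n => by
    rw [h.s_eq]
    exact H.mul_mem (H.inv_mem (H.mul_mem (ht _ _ _ _ _) (ht _ _ _ _ _))) (ht _ _ _ _ _)
  have hT : TRel (fun p q r u n => (⟨t p q r u n, ht p q r u n⟩ : H))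
      (fun p q r u n => (⟨s p q r u n, hs p q r u n⟩ : H)) :=
    { add := fun p q r u j k => Subtype.ext (h.add _ _ _ _ _ _)
      conj := fun p q r u p' q' r' u' j k => Subtype.ext (h.conj _ _ _ _ _ _ _ _ _ _)
      split := fun p q r u x y n => Subtype.ext (h.split _ _ _ _ _ _ _)
      left := fun p q r u k => Subtype.ext (h.left _ _ _ _ _)
      right := fun p q r u k => Subtype.ext (h.right _ _ _ _ _) }
  have hpre : ∀ n, {x : H | ∃ p q r u, x = (⟨t p q r u n, ht p q r u n⟩ : H)} =
      Subtype.val ⁻¹' {x | ∃ p q r u, x = t p q r u n} := by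
    intro n; ext x
    simp only [Set.mem_ofPred_eq, Set.mem_preimage, Subtype.ext_iff]
  have htop : Subgroup.closure {x : H | ∃ p q r u, x = (⟨t p q r u 1, ht p q r u 1⟩ : H)} = ⊤ := by
    rw [hpre]; exact Subgroup.closure_closure_coe_preimage
  have hfi := hT.finiteIndex_top htop m hm
  have hle : Subgroup.closure {x : H | ∃ p q r u, x = (⟨t p q r u m, ht p q r u m⟩ : H)} ≤
      (Subgroup.closure {x | ∃ p q r u, x = t p q r u m}).subgroupOf H := by
    rw [Subgroup.closure_le]
    rintro _ ⟨p, q, r, u, rfl⟩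
    exact Subgroup.subset_closure ⟨p, q, r, u, rfl⟩
  exact (Subgroup.finiteIndex_of_le hle).index_ne_zero

end finite_quotient

section level

variable {G : Type*} [Group G] {t s : ℤ → ℤ → ℤ → ℤ → ℤ → G}

theorem TRel.level (h : TRel t s)
    (pm : ∀ p q r u x y n, t (x*p) (x*q) (y*r) (y*u) n * t (x*p) (x*q) (-y*r) (-y*u) n =
      t p q 0 0 (2*x*x*n) * t 0 0 r u (2*y*y*n))
    (K : Subgroup G) (a c : G) (haK : a ∈ K) (hcK : c ∈ K)
    (ha : ∀ p q r u k, a * t p q r u k = t (-p-r) (-2*q+u) (q-u) (p+2*r) k * a)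
    (hc : ∀ p q r u k, c * t p q r u k = t p q (-r) (-u) k * c)
    (h0 : t 1 (-1) 0 (-1) (-6) ∈ K) (p q r u : ℤ) : t p q r u (6912*6912*6912) ∈ K := by
  have A : ∀ {p q r u n : ℤ} (p' q' r' u' : ℤ), t p q r u n ∈ K → p' = -p-r → q' = -2*q+u →
      r' = q-u → u' = p+2*r → t p' q' r' u' n ∈ K := by
    rintro p q r u n _ _ _ _ h rfl rfl rfl rfl
    have := ha p q r u n
    rw [← mul_inv_eq_iff_eq_mul] at this
    rw [← this]
    exact K.mul_mem (K.mul_mem haK h) (K.inv_mem haK)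
  have A' : ∀ {p q r u n : ℤ} (p' q' r' u' : ℤ), t p q r u n ∈ K → p = -p'-r' → q = -2*q'+u' →
      r = q'-u' → u = p'+2*r' → t p' q' r' u' n ∈ K := by
    rintro _ _ _ _ n p q r u h rfl rfl rfl rfl
    have := ha p q r u n
    rw [← eq_inv_mul_iff_mul_eq] at this
    rw [this]
    exact K.mul_mem (K.inv_mem haK) (K.mul_mem h haK)
  have C : ∀ {p q r u n : ℤ} (r' u' : ℤ), t p q r u n ∈ K → r' = -r → u' = -u →
      t p q r' u' n ∈ K := by
    rintro p q r u n _ _ h rfl rfl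
    have := hc p q r u n
    rw [← mul_inv_eq_iff_eq_mul] at this
    rw [← this]
    exact K.mul_mem (K.mul_mem hcK h) (K.inv_mem hcK)
  have M : ∀ {p q r u n : ℤ} (n' j : ℤ), t p q r u n ∈ K → n' = j * n → t p q r u n' ∈ K := by
    rintro p q r u n _ j h' rfl
    rw [← h.t_zpow]; exact K.zpow_mem h' j
  have PM : ∀ (p q r u x y n n1 n2 : ℤ) {a1 a2 b1 b2 c2 d2 : ℤ}, t a1 a2 b1 b2 n ∈ K →
      t a1 a2 c2 d2 n ∈ K → a1 = x*p → a2 = x*q → b1 = y*r → b2 = y*u → c2 = -y*r → d2 = -y*u →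
      n1 = 2*x*x*n → n2 = 2*y*y*n → t p q 0 0 n1 * t 0 0 r u n2 ∈ K := by
    rintro p q r u x y n _ _ _ _ _ _ _ _ h1 h2 rfl rfl rfl rfl rfl rfl rfl rfl
    rw [← pm]; exact K.mul_mem h1 h2
  have SP : ∀ (p q r u x y n n1 n2 n3 : ℤ) {a1 a2 b1 b2 : ℤ}, t a1 a2 b1 b2 n ∈ K →
      a1 = x*p → a2 = x*q → b1 = y*r → b2 = y*u → n1 = x*x*n → n2 = y*y*n → n3 = x*y*n →
      t p q 0 0 n1 ∈ K → t 0 0 r u n2 ∈ K → s p q r u n3 ∈ K := by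
    rintro p q r u x y n _ _ _ _ _ _ _ h1 rfl rfl rfl rfl rfl rfl rfl h2 h3
    rw [h.split] at h1
    exact (K.mul_mem_cancel_left (K.mul_mem h2 h3)).1 h1
  have g1 : t 1 (-1) 0 (-1) 6 ∈ K := M _ (-1) h0 (by norm_num)
  have g2 : t 1 (-1) 0 1 6 ∈ K := C _ _ g1 (by norm_num) (by norm_num)
  have g3 : t (-1) 3 (-2) 1 6 ∈ K :=
    A _ _ _ _ g2 (by norm_num) (by norm_num) (by norm_num) (by norm_num)
  have g4 : t 3 (-5) 2 (-5) 6 ∈ K :=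
    A _ _ _ _ g3 (by norm_num) (by norm_num) (by norm_num) (by norm_num)
  have g5 : t (-5) 5 0 7 6 ∈ K :=
    A _ _ _ _ g4 (by norm_num) (by norm_num) (by norm_num) (by norm_num)
  have g6 : t (-5) 5 0 (-7) 6 ∈ K := C _ _ g5 (by norm_num) (by norm_num)
  have k1 : t 1 (-1) 0 0 300 * t 0 0 0 1 300 ∈ K :=
    PM 1 (-1) 0 1 1 1 150 300 300 (M 150 25 g2 (by norm_num)) (M 150 25 g1 (by norm_num))
      (by norm_num) (by norm_num) (by norm_num) (by norm_num) (by norm_num) (by norm_num)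
      (by norm_num) (by norm_num)
  have k2 : t 1 (-1) 0 0 300 * t 0 0 0 1 588 ∈ K :=
    PM 1 (-1) 0 1 (-5) 7 6 300 588 g5 g6
      (by norm_num) (by norm_num) (by norm_num) (by norm_num) (by norm_num) (by norm_num)
      (by norm_num) (by norm_num)
  have f2 : t 0 0 0 1 288 ∈ K := by
    have := K.mul_mem (K.inv_mem k1) k2
    have e : t 0 0 0 1 588 = t 0 0 0 1 300 * t 0 0 0 1 288 := by rw [h.add]; norm_num
    rw [e] at this
    simpa [mul_assoc] using this
  have b1 : t 0 1 (-1) 0 288 ∈ K :=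
    A _ _ _ _ f2 (by norm_num) (by norm_num) (by norm_num) (by norm_num)
  have b2 : t 0 1 1 0 288 ∈ K := C _ _ b1 (by norm_num) (by norm_num)
  have b3 : t (-1) 0 1 0 288 ∈ K :=
    A' _ _ _ _ f2 (by norm_num) (by norm_num) (by norm_num) (by norm_num)
  have b4 : t (-1) 0 (-1) 0 288 ∈ K := C _ _ b3 (by norm_num) (by norm_num)
  have b5 : t 0 (-2) 0 (-3) 288 ∈ K :=
    A' _ _ _ _ b2 (by norm_num) (by norm_num) (by norm_num) (by norm_num)
  have b6 : t 0 (-2) 0 3 288 ∈ K := C _ _ b5 (by norm_num) (by norm_num)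
  have b7 : t 2 0 0 (-3) 288 ∈ K :=
    A _ _ _ _ b4 (by norm_num) (by norm_num) (by norm_num) (by norm_num)
  have b8 : t 2 0 0 3 288 ∈ K := C _ _ b7 (by norm_num) (by norm_num)
  have f1 : t 0 1 0 0 2304 ∈ K := by
    have := PM 0 1 0 1 (-2) 3 288 2304 5184 b6 b5
      (by norm_num) (by norm_num) (by norm_num) (by norm_num) (by norm_num) (by norm_num)
      (by norm_num) (by norm_num)
    exact (K.mul_mem_cancel_right (M _ 18 f2 (by norm_num))).1 this
  have e2 : t 0 0 1 0 2304 ∈ K := by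
    have := PM 0 1 1 0 1 1 1152 2304 2304 (M _ 4 b2 (by norm_num)) (M _ 4 b1 (by norm_num))
      (by norm_num) (by norm_num) (by norm_num) (by norm_num) (by norm_num) (by norm_num)
      (by norm_num) (by norm_num)
    exact (K.mul_mem_cancel_left f1).1 this
  have e1 : t 1 0 0 0 2304 ∈ K := by
    have := PM 1 0 1 0 (-1) 1 1152 2304 2304 (M _ 4 b3 (by norm_num)) (M _ 4 b4 (by norm_num))
      (by norm_num) (by norm_num) (by norm_num) (by norm_num) (by norm_num) (by norm_num)
      (by norm_num) (by norm_num)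
    exact (K.mul_mem_cancel_right e2).1 this
  have s14 : ∀ j, s 1 0 0 1 (6912*j) ∈ K := fun j =>
    SP 1 0 0 1 2 3 (1152*j) (4608*j) (10368*j) _ (M _ (4*j) b8 (by ring))
      (by norm_num) (by norm_num) (by norm_num) (by norm_num) (by ring) (by ring) (by ring)
      (M _ (2*j) e1 (by ring)) (M _ (36*j) f2 (by ring))
  have s24 : ∀ j, s 0 1 0 1 (6912*j) ∈ K := fun j =>
    SP 0 1 0 1 (-2) (-3) (1152*j) (4608*j) (10368*j) _ (M _ (4*j) b5 (by ring))
      (by norm_num) (by norm_num) (by norm_num) (by norm_num) (by ring) (by ring) (by ring)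
      (M _ (2*j) f1 (by ring)) (M _ (36*j) f2 (by ring))
  have s13 : ∀ j, s 1 0 1 0 (6912*j) ∈ K := fun j =>
    SP 1 0 1 0 (-1) (-1) (6912*j) (6912*j) (6912*j) _ (M _ (24*j) b4 (by ring))
      (by norm_num) (by norm_num) (by norm_num) (by norm_num) (by ring) (by ring) (by ring)
      (M _ (3*j) e1 (by ring)) (M _ (3*j) e2 (by ring))
  have SP' : ∀ (p q r u n : ℤ), t p q 0 0 n ∈ K → t 0 0 r u n ∈ K → s p q r u n ∈ K →
      t p q r u n ∈ K := by
    intro p q r u n h1 h2 h3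
    have := h.split p q r u 1 1 n
    simp only [one_mul] at this
    rw [this]; exact K.mul_mem (K.mul_mem h1 h2) h3
  have e1' : ∀ j, t 1 0 0 0 (6912*j) ∈ K := fun j => M _ (3*j) e1 (by ring)
  have f1' : ∀ j, t 0 1 0 0 (6912*j) ∈ K := fun j => M _ (3*j) f1 (by ring)
  have e2' : ∀ j, t 0 0 1 0 (6912*j) ∈ K := fun j => M _ (3*j) e2 (by ring)
  have f2' : ∀ j, t 0 0 0 1 (6912*j) ∈ K := fun j => M _ (24*j) f2 (by ring)
  have := h.word K 6912 e1' f1' e2' f2'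
    (fun j => SP' _ _ _ _ _ (e1' j) (e2' j) (s13 j))
    (fun j => SP' _ _ _ _ _ (e1' j) (f2' j) (s14 j))
    (fun j => M _ (24*j) b2 (by ring))
    (fun j => SP' _ _ _ _ _ (f1' j) (f2' j) (s24 j)) p q r u 1
  rwa [mul_one] at this

end level

theorem tG_pm (p q r u x y n : ℤ) :
    tG (x*p) (x*q) (y*r) (y*u) n * tG (x*p) (x*q) (-y*r) (-y*u) n =
      tG p q 0 0 (2*x*x*n) * tG 0 0 r u (2*y*y*n) := by
  apply Units.ext
  change tM _ _ _ _ _ * tM _ _ _ _ _ = tM _ _ _ _ _ * tM _ _ _ _ _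
  ext i l
  fin_cases i <;> fin_cases l <;> simp [tM, Matrix.mul_apply, Fin.sum_univ_five] <;> ring

/-- The conjugate of `matA` in the new basis. -/
def matA' : Matrix (Fin 5) (Fin 5) ℤ :=
  !![0,-1,-2,1,0; 1,0,0,0,0; 0,1,3,-2,0; 0,0,0,0,1; 0,1,4,-4,0]

/-- The conjugate of `matB` in the new basis. -/
def matB' : Matrix (Fin 5) (Fin 5) ℤ :=
  !![0,-1,2,1,0; 1,0,0,0,0; 0,1,-3,-2,0; 0,0,0,0,1; 0,1,-4,-4,0]

/-- The reflection in the middle coordinate. -/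
def matC' : Matrix (Fin 5) (Fin 5) ℤ :=
  !![1,0,0,0,0; 0,1,0,0,0; 0,0,-1,0,0; 0,0,0,1,0; 0,0,0,0,1]

theorem matA'_tM (p q r u k : ℤ) :
    matA' * tM p q r u k = tM (-p-r) (-2*q+u) (q-u) (p+2*r) k * matA' := by
  ext i l
  fin_cases i <;> fin_cases l <;> simp [tM, matA', Matrix.mul_apply, Fin.sum_univ_five] <;>
    ring_nf <;> simp

theorem matC'_tM (p q r u k : ℤ) :
    matC' * tM p q r u k = tM p q (-r) (-u) k * matC' := by
  ext i l
  fin_cases i <;> fin_cases l <;> simp [tM, matC', Matrix.mul_apply, Fin.sum_univ_five]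

theorem matA'_pow : matA' ^ 6 = tM 1 (-1) 0 (-1) (-6) := by decide +kernel

theorem matA'_matC' : matA' * matC' = matB' := by decide +kernel

theorem level_GL (K : Subgroup (GL (Fin 5) ℤ)) (a b : GL (Fin 5) ℤ) (haK : a ∈ K) (hbK : b ∈ K)
    (ha : (a : Matrix (Fin 5) (Fin 5) ℤ) = matA') (hb : (b : Matrix (Fin 5) (Fin 5) ℤ) = matB') :
    Subgroup.closure {x | ∃ p q r u, x = tG p q r u (6912*6912*6912)} ≤ K := by
  have hc : ((a⁻¹ * b : GL (Fin 5) ℤ) : Matrix (Fin 5) (Fin 5) ℤ) = matC' := by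
    rw [Units.val_mul, hb, ← matA'_matC', ← mul_assoc, ← ha, Units.inv_mul, one_mul]
  rw [Subgroup.closure_le]
  rintro _ ⟨p, q, r, u, rfl⟩
  refine trel_GL.level tG_pm K a (a⁻¹ * b) haK (K.mul_mem (K.inv_mem haK) hbK) ?_ ?_ ?_ p q r u
  · intro p q r u k
    apply Units.ext
    rw [Units.val_mul, Units.val_mul, ha]
    exact matA'_tM p q r u k
  · intro p q r u k
    apply Units.ext
    rw [Units.val_mul _ (a⁻¹ * b), Units.val_mul (a⁻¹ * b), hc]
    exact matC'_tM p q r u k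
  · have : a ^ 6 = tG 1 (-1) 0 (-1) (-6) := by
      apply Units.ext
      rw [Units.val_pow_eq_pow_val, ha]
      exact matA'_pow
    rw [← this]; exact K.pow_mem haK 6

section euclid

/-- The subgroup generated by all the transvections. -/
def HH : Subgroup (GL (Fin 5) ℤ) := Subgroup.closure {x | ∃ p q r u, x = tG p q r u 1}

theorem tG_mem (p q r u n : ℤ) : tG p q r u n ∈ HH := by
  have := trel_GL.t_zpow p q r u 1 n
  rw [mul_one] at this
  rw [← this]
  exact HH.zpow_mem (Subgroup.subset_closure ⟨p, q, r, u, rfl⟩) n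

theorem sG_mem (p q r u n : ℤ) : sG p q r u n ∈ HH := by
  rw [trel_GL.s_eq]
  exact HH.mul_mem (HH.inv_mem (HH.mul_mem (tG_mem _ _ _ _ _) (tG_mem _ _ _ _ _)))
    (tG_mem _ _ _ _ _)

theorem act_te1 (j c a s b d : ℤ) :
    tM 1 0 0 0 j *ᵥ ![c, a, s, b, d] = ![c + j*b, a - j*d, s, b, d] := by
  ext i; fin_cases i <;> simp [tM, Matrix.mulVec, dotProduct, Fin.sum_univ_five] <;> ring

theorem act_te2 (j c a s b d : ℤ) :
    tM 0 0 1 0 j *ᵥ ![c, a, s, b, d] = ![c - j*a, a, s, b + j*d, d] := by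
  ext i; fin_cases i <;> simp [tM, Matrix.mulVec, dotProduct, Fin.sum_univ_five]; ring

theorem act_tf2 (j c a s b d : ℤ) :
    tM 0 0 0 1 j *ᵥ ![c, a, s, b, d] = ![c, a + j*c, s, b, d - j*b] := by
  ext i; fin_cases i <;> simp [tM, Matrix.mulVec, dotProduct, Fin.sum_univ_five] <;> ring

theorem act_see (j c a s b d : ℤ) :
    sM 1 0 1 0 j *ᵥ ![c, a, s, b, d] = ![c + 2*j*s - j*j*d, a, s - j*d, b, d] := by
  ext i; fin_cases i <;> simp [sM, Matrix.mulVec, dotProduct, Fin.sum_univ_five] <;> ring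

theorem act_sef (j c a s b d : ℤ) :
    sM 1 0 0 1 j *ᵥ ![c, a, s, b, d] = ![c, a - 2*j*s - j*j*b, s + j*b, b, d] := by
  ext i; fin_cases i <;> simp [sM, Matrix.mulVec, dotProduct, Fin.sum_univ_five]; ring

theorem act_sfe (j c a s b d : ℤ) :
    sM 0 1 1 0 j *ᵥ ![c, a, s, b, d] = ![c, a, s - j*a, b - j*j*a + 2*j*s, d] := by
  ext i; fin_cases i <;> simp [sM, Matrix.mulVec, dotProduct, Fin.sum_univ_five] <;> ring

theorem act_sff (j c a s b d : ℤ) :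
    sM 0 1 0 1 j *ᵥ ![c, a, s, b, d] = ![c, a, s - j*c, b, d - j*j*c + 2*j*s] := by
  ext i; fin_cases i <;> simp [sM, Matrix.mulVec, dotProduct, Fin.sum_univ_five] <;> ring

/-- Two vectors in the same orbit of `HH`. -/
def Mv (x y : Fin 5 → ℤ) : Prop := ∃ h ∈ HH, (h : Matrix (Fin 5) (Fin 5) ℤ) *ᵥ x = y

theorem Mv.trans {x y z : Fin 5 → ℤ} (h1 : Mv x y) (h2 : Mv y z) : Mv x z := by
  obtain ⟨g, hg, rfl⟩ := h1
  obtain ⟨h, hh, rfl⟩ := h2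
  exact ⟨h * g, HH.mul_mem hh hg, by rw [Units.val_mul, Matrix.mulVec_mulVec]⟩

theorem Mv.refl (x : Fin 5 → ℤ) : Mv x x := ⟨1, HH.one_mem, by simp⟩

/-- The orbit relation for the middle part. -/
def Mv3 (a s b a' s' b' : ℤ) : Prop :=
  ∃ h ∈ HH, ∀ c d, (h : Matrix (Fin 5) (Fin 5) ℤ) *ᵥ ![c, a, s, b, d] = ![c, a', s', b', d]

theorem Mv3.trans {a s b a' s' b' a'' s'' b'' : ℤ} (h1 : Mv3 a s b a' s' b')
    (h2 : Mv3 a' s' b' a'' s'' b'') : Mv3 a s b a'' s'' b'' := by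
  obtain ⟨g, hg, h1⟩ := h1
  obtain ⟨h, hh, h2⟩ := h2
  exact ⟨h * g, HH.mul_mem hh hg, fun c d => by
    rw [Units.val_mul, ← Matrix.mulVec_mulVec, h1, h2]⟩

theorem mv3_sef (j a s b : ℤ) : Mv3 a s b (a - 2*j*s - j*j*b) (s + j*b) b :=
  ⟨sG 1 0 0 1 j, sG_mem _ _ _ _ _, fun c d => act_sef j c a s b d⟩

theorem mv3_sfe (j a s b : ℤ) : Mv3 a s b a (s - j*a) (b - j*j*a + 2*j*s) :=
  ⟨sG 0 1 1 0 j, sG_mem _ _ _ _ _, fun c d => act_sfe j c a s b d⟩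

theorem abs_lt_aux (x b y : ℤ) (hb : b ≠ 0) (h : x*b + y*y = 0) (h0 : 0 ≤ y) (h1 : y < |b|) :
    |x| < |b| := by
  have hb' : 0 < |b| := abs_pos.2 hb
  have h2 : |x| * |b| = y*y := by
    rw [← abs_mul, show x*b = -(y*y) by linarith, abs_neg, abs_mul_self]
  have h3 : |x| * |b| < |b| * |b| := by rw [h2]; nlinarith
  exact lt_of_mul_lt_mul_right h3 hb'.le

theorem phase2 (n : ℕ) : ∀ a s b : ℤ, a*b + s*s = 0 → |a| + |b| ≤ n → ∃ a', Mv3 a s b a' 0 0 := by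
  induction n using Nat.strong_induction_on with
  | _ n ih =>
  intro a s b h hn
  by_cases hb : b = 0
  · subst hb
    have hs : s = 0 := by simpa using h
    subst hs
    exact ⟨a, 1, HH.one_mem, by simp⟩
  by_cases ha : a = 0
  · subst ha
    have hs : s = 0 := by simpa using h
    subst hs
    refine ⟨-b, (mv3_sef 1 0 0 b).trans ?_⟩
    have := mv3_sfe (-1) (0 - 2*1*0 - 1*1*b) (0 + 1*b) b
    ring_nf at this ⊢
    exact this
  have hb' : 0 < |b| := abs_pos.2 hb
  have ha' : 0 < |a| := abs_pos.2 ha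
  by_cases hab : |b| ≤ |a|
  · have e1 : s + -(s / b) * b = s % b := by rw [Int.emod_def]; ring
    have h1 := mv3_sef (-(s / b)) a s b
    rw [e1] at h1
    have h2 : (a - 2*(-(s/b))*s - (-(s/b))*(-(s/b))*b) * b + (s % b)*(s % b) = 0 := by
      rw [← e1]; linear_combination h
    have h3 := abs_lt_aux _ _ _ hb h2 (Int.emod_nonneg _ hb) (Int.emod_lt_abs _ hb)
    set x := a - 2*(-(s/b))*s - (-(s/b))*(-(s/b))*b with hx
    obtain ⟨a', h4⟩ := ih (|x| + |b|).toNat (by omega) x (s % b) b h2 (by omega)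
    exact ⟨a', h1.trans h4⟩
  · have e1 : s - (s / a) * a = s % a := by rw [Int.emod_def]; ring
    have h1 := mv3_sfe (s / a) a s b
    rw [e1] at h1
    have h2 : (b - (s/a)*(s/a)*a + 2*(s/a)*s) * a + (s % a)*(s % a) = 0 := by
      rw [← e1]; linear_combination h
    have h3 := abs_lt_aux _ _ _ ha h2 (Int.emod_nonneg _ ha) (Int.emod_lt_abs _ ha)
    set x := b - (s/a)*(s/a)*a + 2*(s/a)*s with hx
    obtain ⟨a', h4⟩ := ih (|a| + |x|).toNat (by omega) a (s % a) x (by linarith) (by omega)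
    exact ⟨a', h1.trans h4⟩

theorem balanced (x d : ℤ) (hd : d ≠ 0) : ∃ j, 2 * |x - j*d| ≤ |d| := by
  have h0 := Int.emod_nonneg x hd
  have h1 := Int.emod_lt_abs x hd
  have h2 : x - (x/d)*d = x % d := by rw [Int.emod_def]; ring
  by_cases h : 2 * (x % d) ≤ |d|
  · exact ⟨x/d, by rw [h2, abs_of_nonneg h0]; exact h⟩
  · refine ⟨x/d + d.sign, ?_⟩
    have h3 : x - (x/d + d.sign)*d = x % d - |d| := by
      rw [← h2, ← Int.sign_mul_self_eq_abs]; ring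
    rw [h3, abs_of_nonpos (by linarith)]
    linarith

theorem mv_swap (c a s b d : ℤ) : Mv ![c, a, s, b, d] ![-d, a, -s, b, -c] := by
  refine ⟨sG 1 0 1 0 1 * (sG 0 1 0 1 1 * sG 1 0 1 0 1), HH.mul_mem (sG_mem _ _ _ _ _)
    (HH.mul_mem (sG_mem _ _ _ _ _) (sG_mem _ _ _ _ _)), ?_⟩
  change (sM 1 0 1 0 1 * (sM 0 1 0 1 1 * sM 1 0 1 0 1)) *ᵥ _ = _
  rw [← Matrix.mulVec_mulVec, ← Matrix.mulVec_mulVec, act_see, act_sff, act_see]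
  ring_nf

theorem phase1 (n : ℕ) : ∀ c a s b d : ℤ, c*d + a*b + s*s = 0 → |d| ≤ n →
    ∃ c' a' s' b', Mv ![c, a, s, b, d] ![c', a', s', b', 0] ∧ a'*b' + s'*s' = 0 := by
  induction n using Nat.strong_induction_on with
  | _ n ih =>
  intro c a s b d h hn
  by_cases hd : d = 0
  · subst hd
    exact ⟨c, a, s, b, Mv.refl _, by linarith⟩
  obtain ⟨i, hi⟩ := balanced a d hd
  obtain ⟨j, hj⟩ := balanced s d hd
  obtain ⟨k, hk⟩ := balanced b d hd
  have m1 : Mv ![c, a, s, b, d] _ := ⟨tG 1 0 0 0 i, tG_mem _ _ _ _ _, act_te1 i c a s b d⟩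
  have m2 : Mv ![c + i*b, a - i*d, s, b, d] _ :=
    ⟨tG 0 0 1 0 (-k), tG_mem _ _ _ _ _, act_te2 (-k) _ _ _ _ _⟩
  have m3 := (m1.trans m2).trans
    ⟨sG 1 0 1 0 j, sG_mem _ _ _ _ _, act_see j _ _ _ _ _⟩
  have m4 := m3.trans (mv_swap _ _ _ _ _)
  have e : b + -k*d = b - k*d := by ring
  rw [e] at m4
  have h2 : (c + i*b - -k*(a - i*d) + 2*j*s - j*j*d) * d + (a - i*d)*(b - k*d)
      + (s - j*d)*(s - j*d) = 0 := by linear_combination h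
  set C := c + i*b - -k*(a - i*d) + 2*j*s - j*j*d with hC
  set A := a - i*d with hA
  set S := s - j*d with hS
  set B := b - k*d with hB
  have hd' : 0 < |d| := abs_pos.2 hd
  have h3 : |C| < |d| := by
    have h4 : |C| * |d| ≤ |A| * |B| + |S| * |S| := by
      rw [← abs_mul, ← abs_mul, ← abs_mul, show C*d = -(A*B + S*S) by linarith, abs_neg]
      exact abs_add_le _ _
    have := abs_nonneg A
    have := abs_nonneg B
    have := abs_nonneg S
    have h5 : 4 * (|A| * |B|) ≤ |d| * |d| := by nlinarith
    have h6 : 4 * (|S| * |S|) ≤ |d| * |d| := by nlinarith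
    nlinarith
  obtain ⟨c', a', s', b', h7, h8⟩ := ih |C|.toNat (by have := abs_nonneg C; omega)
    (-d) A (-S) B (-C) (by linarith) (by rw [abs_neg]; have := abs_nonneg C; omega)
  exact ⟨c', a', s', b', m4.trans h7, h8⟩

theorem phase3 (n : ℕ) : ∀ c a : ℤ, |a| ≤ n →
    ∃ c', Mv ![c, a, 0, 0, 0] ![c', 0, 0, 0, 0] := by
  induction n using Nat.strong_induction_on with
  | _ n ih =>
  intro c a hn
  by_cases ha : a = 0
  · subst ha; exact ⟨c, Mv.refl _⟩
  have m1 : Mv ![c, a, 0, 0, 0] ![-a, c % a, 0, 0, 0] := by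
    refine ⟨tG 0 0 0 1 1 * (tG 0 0 1 0 1 * (tG 0 0 0 1 1 * tG 0 0 1 0 (c / a))),
      HH.mul_mem (tG_mem _ _ _ _ _) (HH.mul_mem (tG_mem _ _ _ _ _)
        (HH.mul_mem (tG_mem _ _ _ _ _) (tG_mem _ _ _ _ _))), ?_⟩
    change (tM 0 0 0 1 1 * (tM 0 0 1 0 1 * (tM 0 0 0 1 1 * tM 0 0 1 0 (c / a)))) *ᵥ _ = _
    rw [← Matrix.mulVec_mulVec, ← Matrix.mulVec_mulVec, ← Matrix.mulVec_mulVec,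
      act_te2, act_tf2, act_te2, act_tf2, Int.emod_def]
    ring_nf
  have h1 := Int.emod_lt_abs c ha
  have h0 := Int.emod_nonneg c ha
  obtain ⟨c', h⟩ := ih (c % a).toNat (by omega) (-a) (c % a) (by rw [abs_of_nonneg h0]; omega)
  exact ⟨c', m1.trans h⟩

theorem isotropic (c a s b d : ℤ) (h : c*d + a*b + s*s = 0) :
    ∃ c', Mv ![c, a, s, b, d] ![c', 0, 0, 0, 0] := by
  obtain ⟨c1, a1, s1, b1, h1, h2⟩ := phase1 |d|.toNat c a s b d h (by have := abs_nonneg d; omega)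
  obtain ⟨a2, g, hg, h3⟩ := phase2 (|a1| + |b1|).toNat a1 s1 b1 h2
    (by have := abs_nonneg a1; have := abs_nonneg b1; omega)
  obtain ⟨c', h4⟩ := phase3 |a2|.toNat c1 a2 (by have := abs_nonneg a2; omega)
  exact ⟨c', (h1.trans ⟨g, hg, h3 c1 0⟩).trans h4⟩

end euclid

section reduction

theorem col_mul (h M : Matrix (Fin 5) (Fin 5) ℤ) (l : Fin 5) (x : Fin 5 → ℤ)
    (H : h *ᵥ ![M 0 l, M 1 l, M 2 l, M 3 l, M 4 l] = x) (i : Fin 5) : (h * M) i l = x i := by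
  rw [← H, Matrix.mul_apply]
  simp [Matrix.mulVec, dotProduct, Fin.sum_univ_five]

theorem col_mul' (h M : Matrix (Fin 5) (Fin 5) ℤ) (l : Fin 5) (x y : Fin 5 → ℤ)
    (H : h *ᵥ x = y) (hx : ∀ i, M i l = x i) (i : Fin 5) : (h * M) i l = y i := by
  rw [← H, Matrix.mul_apply]
  simp only [Matrix.mulVec, dotProduct, hx]

/-- Orthogonality for the form `matJ`. -/
def OO (M : Matrix (Fin 5) (Fin 5) ℤ) : Prop := Mᵀ * matJ * M = matJ

theorem OO.entry {M : Matrix (Fin 5) (Fin 5) ℤ} (h : OO M) (i l : Fin 5) :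
    M 0 i * M 4 l + M 1 i * M 3 l + 2 * (M 2 i * M 2 l) + M 3 i * M 1 l + M 4 i * M 0 l
      = matJ i l := by
  have := congrFun (congrFun h i) l
  rw [← this]
  simp [Matrix.mul_apply, Fin.sum_univ_five, matJ]
  ring

theorem OO.mul {M N : Matrix (Fin 5) (Fin 5) ℤ} (hM : OO M) (hN : OO N) : OO (M * N) := by
  unfold OO at *
  calc (M * N)ᵀ * matJ * (M * N) = Nᵀ * (Mᵀ * matJ * M) * N := by
        simp only [transpose_mul, mul_assoc]
    _ = matJ := by rw [hM, hN]

theorem HH_le : HH ≤ orthogonalSubgroup matJ := by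
  unfold HH
  rw [Subgroup.closure_le]
  rintro _ ⟨p, q, r, u, rfl⟩
  exact tM_orth p q r u 1

theorem HH_OO {h : GL (Fin 5) ℤ} (hh : h ∈ HH) : OO (h : Matrix (Fin 5) (Fin 5) ℤ) := HH_le hh

theorem unit_cases {x y : ℤ} (h : x * y = 1) : (x = 1 ∧ y = 1) ∨ (x = -1 ∧ y = -1) := by
  rcases Int.eq_one_or_neg_one_of_mul_eq_one h with rfl | rfl
  · left; constructor <;> linarith
  · right; constructor <;> linarith

/-- Diagonal sign matrices. -/
def dM (x y z : ℤ) : Matrix (Fin 5) (Fin 5) ℤ :=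
  !![x, 0, 0, 0, 0; 0, y, 0, 0, 0; 0, 0, z, 0, 0; 0, 0, 0, y, 0; 0, 0, 0, 0, x]

theorem stage1 (M : Matrix (Fin 5) (Fin 5) ℤ) (hM : OO M) :
    ∃ h ∈ HH, ∃ c, ∀ i, ((h : Matrix (Fin 5) (Fin 5) ℤ) * M) i 0 = ![c, 0, 0, 0, 0] i := by
  have h1 := hM.entry 0 0
  have h2 : M 0 0 * M 4 0 + M 1 0 * M 3 0 + M 2 0 * M 2 0 = 0 := by
    have : matJ 0 0 = 0 := rfl
    rw [this] at h1
    linarith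
  obtain ⟨c, h, hh, hc⟩ := isotropic _ _ _ _ _ h2
  exact ⟨h, hh, c, col_mul _ _ _ _ hc⟩

theorem stage2 (M : Matrix (Fin 5) (Fin 5) ℤ) (hM : OO M) (c : ℤ)
    (h0 : ∀ i, M i 0 = ![c, 0, 0, 0, 0] i) :
    ∃ h ∈ HH, ∃ c, (c = 1 ∨ c = -1) ∧
      (∀ i, ((h : Matrix (Fin 5) (Fin 5) ℤ) * M) i 0 = ![c, 0, 0, 0, 0] i) ∧
      (∀ i, ((h : Matrix (Fin 5) (Fin 5) ℤ) * M) i 4 = ![0, 0, 0, 0, c] i) := by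
  have a0 : M 0 0 = c := h0 0
  have a1 : M 1 0 = 0 := h0 1
  have a2 : M 2 0 = 0 := h0 2
  have a3 : M 3 0 = 0 := h0 3
  have a4 : M 4 0 = 0 := h0 4
  have e := hM.entry 0 4
  have : matJ 0 4 = 1 := rfl
  rw [a0, a1, a2, a3, a4, this] at e
  have e' : c * M 4 4 = 1 := by linarith
  have hcc : c * c = 1 ∧ M 4 4 = c ∧ (c = 1 ∨ c = -1) := by
    rcases unit_cases e' with ⟨h, h'⟩ | ⟨h, h'⟩ <;> rw [h, h'] <;> norm_num
  obtain ⟨hcc, h44, hc⟩ := hcc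
  let h := sG 1 0 1 0 (c * M 2 4) * (tG 0 0 1 0 (-(c * M 3 4)) * tG 1 0 0 0 (c * M 1 4))
  have hh : h ∈ HH := HH.mul_mem (sG_mem _ _ _ _ _) (HH.mul_mem (tG_mem _ _ _ _ _)
    (tG_mem _ _ _ _ _))
  have act : ∀ x : Fin 5 → ℤ, (h : Matrix (Fin 5) (Fin 5) ℤ) *ᵥ x =
      sM 1 0 1 0 (c * M 2 4) *ᵥ (tM 0 0 1 0 (-(c * M 3 4)) *ᵥ (tM 1 0 0 0 (c * M 1 4) *ᵥ x)) := by
    intro x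
    rw [Matrix.mulVec_mulVec, Matrix.mulVec_mulVec, mul_assoc]; rfl
  have c0 : ∀ i, ((h : Matrix (Fin 5) (Fin 5) ℤ) * M) i 0 = ![c, 0, 0, 0, 0] i := by
    refine col_mul' _ _ _ _ _ ?_ h0
    rw [act, act_te1, act_te2, act_see]
    simp
  have c4 := col_mul (h : Matrix (Fin 5) (Fin 5) ℤ) M 4 _ rfl
  rw [act, act_te1, act_te2, act_see, h44] at c4
  have hO := ((HH_OO hh).mul hM).entry 4 4
  set N := (h : Matrix (Fin 5) (Fin 5) ℤ) * M with hN
  have n1 : N 1 4 = 0 := by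
    refine (c4 1).trans ?_
    change M 1 4 - c * M 1 4 * c = 0
    linear_combination (-M 1 4) * hcc
  have n2 : N 2 4 = 0 := by
    refine (c4 2).trans ?_
    change M 2 4 - c * M 2 4 * c = 0
    linear_combination (-M 2 4) * hcc
  have n3 : N 3 4 = 0 := by
    refine (c4 3).trans ?_
    change M 3 4 + -(c * M 3 4) * c = 0
    linear_combination (-M 3 4) * hcc
  have n4 : N 4 4 = c := c4 4
  have n0 : N 0 4 = 0 := by
    have : matJ 4 4 = 0 := rfl
    rw [n1, n2, n3, n4, this] at hO
    have : N 0 4 * c = 0 := by linarith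
    linear_combination c * this - N 0 4 * hcc
  refine ⟨h, hh, c, hc, c0, ?_⟩
  intro i
  fin_cases i
  exacts [n0, n1, n2, n3, n4]

theorem stage3 (M : Matrix (Fin 5) (Fin 5) ℤ) (hM : OO M) (c : ℤ) (hc : c = 1 ∨ c = -1)
    (h0 : ∀ i, M i 0 = ![c, 0, 0, 0, 0] i) (h4 : ∀ i, M i 4 = ![0, 0, 0, 0, c] i) :
    ∃ h ∈ HH, ∃ a, 
      (∀ i, ((h : Matrix (Fin 5) (Fin 5) ℤ) * M) i 0 = ![c, 0, 0, 0, 0] i) ∧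
      (∀ i, ((h : Matrix (Fin 5) (Fin 5) ℤ) * M) i 4 = ![0, 0, 0, 0, c] i) ∧
      (∀ i, ((h : Matrix (Fin 5) (Fin 5) ℤ) * M) i 1 = ![0, a, 0, 0, 0] i) := by
  have a0 : M 0 0 = c := h0 0
  have a1 : M 1 0 = 0 := h0 1
  have a2 : M 2 0 = 0 := h0 2
  have a3 : M 3 0 = 0 := h0 3
  have a4 : M 4 0 = 0 := h0 4
  have b0 : M 0 4 = 0 := h4 0
  have b1 : M 1 4 = 0 := h4 1
  have b2 : M 2 4 = 0 := h4 2
  have b3 : M 3 4 = 0 := h4 3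
  have b4 : M 4 4 = c := h4 4
  have c0 : c ≠ 0 := by rcases hc with rfl | rfl <;> norm_num
  have e41 : M 4 1 = 0 := by
    have e := hM.entry 0 1
    have : matJ 0 1 = 0 := rfl
    rw [a0, a1, a2, a3, a4, this] at e
    have : c * M 4 1 = 0 := by linarith
    exact (mul_eq_zero.1 this).resolve_left c0
  have e01 : M 0 1 = 0 := by
    have e := hM.entry 4 1
    have : matJ 4 1 = 0 := rfl
    rw [b0, b1, b2, b3, b4, this] at e
    have : c * M 0 1 = 0 := by linarith
    exact (mul_eq_zero.1 this).resolve_left c0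
  have e11 : M 1 1 * M 3 1 + M 2 1 * M 2 1 = 0 := by
    have e := hM.entry 1 1
    have : matJ 1 1 = 0 := rfl
    rw [e41, e01, this] at e
    linarith
  obtain ⟨a, h, hh, ha⟩ := phase2 (|M 1 1| + |M 3 1|).toNat _ _ _ e11
    (by have := abs_nonneg (M 1 1); have := abs_nonneg (M 3 1); omega)
  have u0 : (h : Matrix (Fin 5) (Fin 5) ℤ) *ᵥ ![c, 0, 0, 0, 0] = ![c, 0, 0, 0, 0] := by
    have : ![c, 0, 0, 0, 0] = ![c, M 1 1, M 2 1, M 3 1, 0] - ![0, M 1 1, M 2 1, M 3 1, 0] := by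
      simp
    rw [this, Matrix.mulVec_sub, ha, ha]; simp
  have u4 : (h : Matrix (Fin 5) (Fin 5) ℤ) *ᵥ ![0, 0, 0, 0, c] = ![0, 0, 0, 0, c] := by
    have : ![0, 0, 0, 0, c] = ![0, M 1 1, M 2 1, M 3 1, c] - ![0, M 1 1, M 2 1, M 3 1, 0] := by
      simp
    rw [this, Matrix.mulVec_sub, ha, ha]; simp
  refine ⟨h, hh, a, col_mul' _ _ _ _ _ u0 h0, col_mul' _ _ _ _ _ u4 h4, col_mul _ _ _ _ ?_⟩
  rw [e01, e41]; exact ha 0 0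

theorem stage4 (M : Matrix (Fin 5) (Fin 5) ℤ) (hM : OO M) (c : ℤ) (hc : c = 1 ∨ c = -1) (a : ℤ)
    (h0 : ∀ i, M i 0 = ![c, 0, 0, 0, 0] i) (h4 : ∀ i, M i 4 = ![0, 0, 0, 0, c] i)
    (h1 : ∀ i, M i 1 = ![0, a, 0, 0, 0] i) :
    ∃ h ∈ HH, ∃ x y z : ℤˣ, (h : Matrix (Fin 5) (Fin 5) ℤ) * M = dM x y z := by
  have c0 : c ≠ 0 := by rcases hc with rfl | rfl <;> norm_num
  have a1 : M 1 1 = a := h1 1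
  have z01 : M 0 1 = 0 := h1 0
  have z21 : M 2 1 = 0 := h1 2
  have z31 : M 3 1 = 0 := h1 3
  have z41 : M 4 1 = 0 := h1 4
  have e : a * M 3 3 = 1 := by
    have e := hM.entry 1 3
    have : matJ 1 3 = 1 := rfl
    rw [a1, z01, z21, z31, z41, this] at e
    linarith
  have haa : a * a = 1 ∧ M 3 3 = a ∧ (a = 1 ∨ a = -1) := by
    rcases unit_cases e with ⟨h, h'⟩ | ⟨h, h'⟩ <;> rw [h, h'] <;> norm_num
  obtain ⟨haa, h33, ha⟩ := haa
  have a0 : a ≠ 0 := by rcases ha with rfl | rfl <;> norm_num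
  refine ⟨sG 1 0 0 1 (-(a * M 2 3)), sG_mem _ _ _ _ _, ?_⟩
  have hO := ((HH_OO (sG_mem 1 0 0 1 (-(a * M 2 3)))).mul hM)
  have k0 := col_mul' _ M 0 _ _ (act_sef (-(a * M 2 3)) c 0 0 0 0) h0
  have k1 := col_mul' _ M 1 _ _ (act_sef (-(a * M 2 3)) 0 a 0 0 0) h1
  have k4 := col_mul' _ M 4 _ _ (act_sef (-(a * M 2 3)) 0 0 0 0 c) h4
  have k3 := col_mul _ M 3 _ (act_sef (-(a * M 2 3)) _ _ _ _ _)
  rw [h33] at k3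
  change OO (sM 1 0 0 1 (-(a * M 2 3)) * M) at hO
  change ∃ x y z : ℤˣ, sM 1 0 0 1 (-(a * M 2 3)) * M = dM x y z
  have n23 : (sM 1 0 0 1 (-(a * M 2 3)) * M) 2 3 = 0 := by
    refine (k3 2).trans ?_
    change M 2 3 + -(a * M 2 3) * a = 0
    linear_combination (-M 2 3) * haa
  have n33 : (sM 1 0 0 1 (-(a * M 2 3)) * M) 3 3 = a := k3 3
  simp only [mul_zero, sub_zero, add_zero] at k0 k1 k4
  clear k3
  generalize sM 1 0 0 1 (-(a * M 2 3)) * M = N at *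
  have k00 : N 0 0 = c := k0 0
  have k10 : N 1 0 = 0 := k0 1
  have k20 : N 2 0 = 0 := k0 2
  have k30 : N 3 0 = 0 := k0 3
  have k40 : N 4 0 = 0 := k0 4
  have k04 : N 0 4 = 0 := k4 0
  have k14 : N 1 4 = 0 := k4 1
  have k24 : N 2 4 = 0 := k4 2
  have k34 : N 3 4 = 0 := k4 3
  have k44 : N 4 4 = c := k4 4
  have k01 : N 0 1 = 0 := k1 0
  have k11 : N 1 1 = a := k1 1
  have k21 : N 2 1 = 0 := k1 2
  have k31 : N 3 1 = 0 := k1 3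
  have k41 : N 4 1 = 0 := k1 4
  have r4 : ∀ l, c * N 4 l = matJ 0 l := fun l => by
    rw [← hO.entry 0 l, k00, k10, k20, k30, k40]; ring
  have r0 : ∀ l, c * N 0 l = matJ 4 l := fun l => by
    rw [← hO.entry 4 l, k04, k14, k24, k34, k44]; ring
  have r3 : ∀ l, a * N 3 l = matJ 1 l := fun l => by
    rw [← hO.entry 1 l, k01, k11, k21, k31, k41]; ring
  have k42 : N 4 2 = 0 := (mul_eq_zero.1 (r4 2)).resolve_left c0
  have k43 : N 4 3 = 0 := (mul_eq_zero.1 (r4 3)).resolve_left c0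
  have k02 : N 0 2 = 0 := (mul_eq_zero.1 (r0 2)).resolve_left c0
  have k03 : N 0 3 = 0 := (mul_eq_zero.1 (r0 3)).resolve_left c0
  have k32 : N 3 2 = 0 := (mul_eq_zero.1 (r3 2)).resolve_left a0
  have k13 : N 1 3 = 0 := by
    have e := hO.entry 3 3
    have : matJ 3 3 = 0 := rfl
    rw [k03, k43, n23, n33, this] at e
    have : a * N 1 3 = 0 := by linarith
    exact (mul_eq_zero.1 this).resolve_left a0
  have r1 : ∀ l, a * N 1 l = matJ 3 l := fun l => by
    rw [← hO.entry 3 l, k03, k13, n23, n33, k43]; ring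
  have k12 : N 1 2 = 0 := (mul_eq_zero.1 (r1 2)).resolve_left a0
  have k22 : N 2 2 * N 2 2 = 1 := by
    have e := hO.entry 2 2
    have : matJ 2 2 = 2 := rfl
    rw [k02, k12, k32, k42, this] at e
    linarith
  obtain ⟨x, hx⟩ : ∃ x : ℤˣ, (x : ℤ) = c := by
    rcases hc with rfl | rfl
    exacts [⟨1, rfl⟩, ⟨-1, rfl⟩]
  obtain ⟨y, hy⟩ : ∃ x : ℤˣ, (x : ℤ) = a := by
    rcases ha with rfl | rfl
    exacts [⟨1, rfl⟩, ⟨-1, rfl⟩]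
  refine ⟨x, y, ⟨N 2 2, N 2 2, k22, k22⟩, ?_⟩
  ext i l
  rw [hx, hy]
  fin_cases i <;> fin_cases l
  exacts [k00, k01, k02, k03, k04, k10, k11, k12, k13, k14, k20, k21, rfl, n23, k24,
    k30, k31, k32, n33, k34, k40, k41, k42, k43, k44]

theorem reduce (g : GL (Fin 5) ℤ) (hg : g ∈ orthogonalSubgroup matJ) :
    ∃ h ∈ HH, ∃ x y z : ℤˣ,
      ((h * g : GL (Fin 5) ℤ) : Matrix (Fin 5) (Fin 5) ℤ) = dM x y z := by
  have hO : OO (g : Matrix (Fin 5) (Fin 5) ℤ) := hg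
  obtain ⟨g1, hg1, c, h1⟩ := stage1 _ hO
  have hO1 := (HH_OO hg1).mul hO
  obtain ⟨g2, hg2, c, hc, h2, h2'⟩ := stage2 _ hO1 c h1
  have hO2 := (HH_OO hg2).mul hO1
  obtain ⟨g3, hg3, a, h3, h3', h3''⟩ := stage3 _ hO2 c hc h2 h2'
  have hO3 := (HH_OO hg3).mul hO2
  obtain ⟨g4, hg4, x, y, z, h4⟩ := stage4 _ hO3 c hc a h3 h3' h3''
  refine ⟨g4 * (g3 * (g2 * g1)),
    HH.mul_mem hg4 (HH.mul_mem hg3 (HH.mul_mem hg2 hg1)), x, y, z, ?_⟩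
  rw [← h4]
  simp only [Units.val_mul, mul_assoc]

theorem dM_mul (x y z : ℤˣ) : dM x y z * dM x y z = 1 := by
  rcases Int.units_eq_one_or x with rfl | rfl <;> rcases Int.units_eq_one_or y with rfl | rfl <;>
    rcases Int.units_eq_one_or z with rfl | rfl <;> decide

theorem dM_OO (x y z : ℤˣ) : OO (dM x y z) := by
  unfold OO
  rcases Int.units_eq_one_or x with rfl | rfl <;> rcases Int.units_eq_one_or y with rfl | rfl <;>
    rcases Int.units_eq_one_or z with rfl | rfl <;> decide

/-- Diagonal sign matrices as elements of `GL₅(ℤ)`. -/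
def dG (x y z : ℤˣ) : GL (Fin 5) ℤ := ⟨dM x y z, dM x y z, dM_mul x y z, dM_mul x y z⟩

theorem HH_relIndex : HH.relIndex (orthogonalSubgroup matJ) ≠ 0 := by
  let f : ℤˣ × ℤˣ × ℤˣ → (orthogonalSubgroup matJ) ⧸ (HH.subgroupOf (orthogonalSubgroup matJ)) :=
    fun v => QuotientGroup.mk ⟨dG v.1 v.2.1 v.2.2, dM_OO v.1 v.2.1 v.2.2⟩
  have hf : Function.Surjective f := by
    intro q
    obtain ⟨g, rfl⟩ := QuotientGroup.mk_surjective q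
    obtain ⟨h, hh, x, y, z, e⟩ := reduce (g⁻¹ : orthogonalSubgroup matJ) (g⁻¹).2
    refine ⟨(x, y, z), ?_⟩
    refine QuotientGroup.eq.2 ?_
    rw [Subgroup.mem_subgroupOf]
    have e' : h * (g : GL (Fin 5) ℤ)⁻¹ = dG x y z := Units.ext e
    have e2 : (dG x y z)⁻¹ = dG x y z := rfl
    change (dG x y z)⁻¹ * (g : GL (Fin 5) ℤ) ∈ HH
    rw [e2, ← e']
    simpa using hh
  have : Finite ((orthogonalSubgroup matJ) ⧸ (HH.subgroupOf (orthogonalSubgroup matJ))) :=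
    Finite.of_surjective f hf
  have : (HH.subgroupOf (orthogonalSubgroup matJ)).FiniteIndex :=
    Subgroup.finiteIndex_of_finite_quotient
  exact this.index_ne_zero

end reduction

section transfer

/-- The change of basis. -/
def matP : Matrix (Fin 5) (Fin 5) ℤ :=
  !![2, 0, 3, 0, -1; 0, 2, 0, -1, 0; 1, 0, 5, 0, -2; 0, 1, 0, -2, 0; 0, 0, 1, 0, 0]

/-- Three times the inverse of `matP`. -/
def matP' : Matrix (Fin 5) (Fin 5) ℤ :=
  !![2, 0, -1, 0, -1; 0, 2, 0, -1, 0; 0, 0, 0, 0, 3; 0, 1, 0, -2, 0; 1, 0, -2, 0, 7]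

/-- One third of `matPᵀ * matQ`. -/
def matR : Matrix (Fin 5) (Fin 5) ℤ :=
  !![1, 0, -2, 0, 7; 0, 1, 0, -2, 0; 0, 0, 0, 0, 6; 0, 2, 0, -1, 0; 2, 0, -1, 0, -1]

/-- Auxiliary matrix with `matP' = matK * matQ + 3 * matD`. -/
def matK : Matrix (Fin 5) (Fin 5) ℤ :=
  !![0, 0, 0, 0, -1; 0, 0, 0, -1, 0; 0, 0, 0, 0, 0; 0, 0, 0, 1, 0; 0, 0, 0, 0, 1]

/-- Auxiliary matrix with `matP' = matK * matQ + 3 * matD`. -/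
def matD : Matrix (Fin 5) (Fin 5) ℤ :=
  !![5, 0, -2, 0, 1; 0, -1, 0, 1, 0; 0, 0, 0, 0, 1; 0, 2, 0, -2, 0; -4, 0, 1, 0, 1]

theorem smul_cancel {n : ℤ} (hn : n ≠ 0) {M N : Matrix (Fin 5) (Fin 5) ℤ} (h : n • M = n • N) :
    M = N := by
  ext i l
  have := congrFun (congrFun h i) l
  simp only [Matrix.smul_apply, smul_eq_mul] at this
  exact mul_left_cancel₀ hn this

theorem PtP_left : matP' * matP = (3 : ℤ) • (1 : Matrix (Fin 5) (Fin 5) ℤ) := by decide +kernel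
theorem PtP_right : matP * matP' = (3 : ℤ) • (1 : Matrix (Fin 5) (Fin 5) ℤ) := by decide +kernel
theorem P'_eq : matP' = matK * matQ + (3 : ℤ) • matD := by decide +kernel
theorem QP_eq : matQ * matP = (3 : ℤ) • matRᵀ := by decide +kernel
theorem PQP_eq : matPᵀ * matQ * matP = (9 : ℤ) • matJ := by decide +kernel
theorem A_P : matA * matP = matP * matA' := by decide +kernel
theorem B_P : matB * matP = matP * matB' := by decide +kernel
theorem A_orth : matAᵀ * matQ * matA = matQ := by decide +kernel
theorem B_orth : matBᵀ * matQ * matB = matQ := by decide +kernel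

theorem P_cancel {M N : Matrix (Fin 5) (Fin 5) ℤ} (h : matP * M = matP * N) : M = N := by
  have := congrArg (matP' * ·) h
  simp only [← mul_assoc, PtP_left, smul_mul_assoc, one_mul] at this
  exact smul_cancel (by norm_num) this

/-- Conjugation by `matP`, in an integral formula. -/
def phiM (g : GL (Fin 5) ℤ) : Matrix (Fin 5) (Fin 5) ℤ :=
  matK * ((g⁻¹ : GL (Fin 5) ℤ) : Matrix (Fin 5) (Fin 5) ℤ)ᵀ * matRᵀ
    + matD * (g : Matrix (Fin 5) (Fin 5) ℤ) * matP

theorem P_phiM (g : GL (Fin 5) ℤ) (hg : g ∈ orthogonalSubgroup matQ) :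
    matP * phiM g = (g : Matrix (Fin 5) (Fin 5) ℤ) * matP := by
  have h1 : (g : Matrix (Fin 5) (Fin 5) ℤ)ᵀ * matQ * g = matQ := hg
  have h2 : ((g⁻¹ : GL (Fin 5) ℤ) : Matrix (Fin 5) (Fin 5) ℤ)ᵀ * matQ = matQ * g := by
    conv_lhs => rw [← h1]
    rw [← mul_assoc, ← mul_assoc, ← transpose_mul, Units.mul_inv]
    simp
  have h3 : (3 : ℤ) • phiM g = matP' * ((g : Matrix (Fin 5) (Fin 5) ℤ) * matP) := by
    rw [P'_eq, add_mul, smul_mul_assoc, phiM, smul_add, ← mul_smul_comm, ← QP_eq]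
    congr 1
    · calc _ = matK * (((g⁻¹ : GL (Fin 5) ℤ) : Matrix (Fin 5) (Fin 5) ℤ)ᵀ * matQ) * matP := by
            simp only [mul_assoc]
        _ = _ := by rw [h2]; simp only [mul_assoc]
    · simp only [mul_assoc]
  apply smul_cancel (n := 3) (by norm_num)
  rw [← mul_smul_comm, h3, ← mul_assoc, PtP_right, smul_mul_assoc, one_mul]

/-- Conjugation by `matP`. -/
def phi : orthogonalSubgroup matQ →* GL (Fin 5) ℤ :=
  MonoidHom.toHomUnits
    { toFun := fun g => phiM g
      map_one' := P_cancel (by rw [P_phiM _ (Subtype.property _)]; simp)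
      map_mul' := fun g h => P_cancel (by
        rw [P_phiM _ (g * h).2, ← mul_assoc, P_phiM _ g.2, mul_assoc, P_phiM _ h.2, ← mul_assoc]
        rfl) }

theorem phi_val (g : orthogonalSubgroup matQ) :
    ((phi g : GL (Fin 5) ℤ) : Matrix (Fin 5) (Fin 5) ℤ) = phiM g := rfl

theorem phi_injective : Function.Injective phi := by
  rw [injective_iff_map_eq_one]
  intro g hg
  have h1 : phiM g = 1 := by rw [← phi_val, hg]; rfl
  have h2 := P_phiM g g.2
  rw [h1, mul_one] at h2
  have h3 := congrArg (· * matP') h2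
  simp only [mul_assoc, PtP_right, mul_smul_comm, mul_one] at h3
  have h4 := smul_cancel (by norm_num) h3
  exact Subtype.ext (Units.ext h4.symm)

theorem phi_range : phi.range ≤ orthogonalSubgroup matJ := by
  rintro _ ⟨g, rfl⟩
  have h1 : ((g : GL (Fin 5) ℤ) : Matrix (Fin 5) (Fin 5) ℤ)ᵀ * matQ *
      ((g : GL (Fin 5) ℤ) : Matrix (Fin 5) (Fin 5) ℤ) = matQ := g.2
  have h2 := P_phiM g g.2
  change (phiM g)ᵀ * matJ * phiM g = matJ
  apply smul_cancel (n := 9) (by norm_num)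
  rw [← smul_mul_assoc, ← mul_smul_comm, ← PQP_eq]
  calc _ = (matP * phiM g)ᵀ * matQ * (matP * phiM g) := by
        simp only [transpose_mul, mul_assoc]
    _ = matPᵀ * (((g : GL (Fin 5) ℤ) : Matrix (Fin 5) (Fin 5) ℤ)ᵀ * matQ *
      ((g : GL (Fin 5) ℤ) : Matrix (Fin 5) (Fin 5) ℤ)) * matP := by
        rw [h2]; simp only [transpose_mul, mul_assoc]
    _ = _ := by rw [h1]

end transfer

/-- Case 15 of Theorem 1.2: the hypergeometric group `Γ(f,g)` generated by the companion matrices `A`, `B`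
of `f(x) = x^5 - 3*x^4 + 5*x^3 - 5*x^2 + 3*x - 1` and `g(x) = x^5 + 3*x^4 + 5*x^3 + 5*x^2 + 3*x + 1`
is an arithmetic subgroup of `O_Q(ℤ)`: it preserves `Q`, it is contained in `O_Q(ℤ)`,
and it has finite index in `O_Q(ℤ)`. -/
theorem hypergeometric_group_arithmetic
    (A B : GL (Fin 5) ℤ)
    (hA : (A : Matrix (Fin 5) (Fin 5) ℤ) = matA)
    (hB : (B : Matrix (Fin 5) (Fin 5) ℤ) = matB) :
    matAᵀ * matQ * matA = matQ ∧
    matBᵀ * matQ * matB = matQ ∧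
    Subgroup.closure {A, B} ≤ orthogonalSubgroup matQ ∧
    ((Subgroup.closure {A, B}).subgroupOf (orthogonalSubgroup matQ)).FiniteIndex := by
  have hAO : A ∈ orthogonalSubgroup matQ := by
    change (A : Matrix (Fin 5) (Fin 5) ℤ)ᵀ * matQ * (A : Matrix (Fin 5) (Fin 5) ℤ) = matQ
    rw [hA]; exact A_orth
  have hBO : B ∈ orthogonalSubgroup matQ := by
    change (B : Matrix (Fin 5) (Fin 5) ℤ)ᵀ * matQ * (B : Matrix (Fin 5) (Fin 5) ℤ) = matQ
    rw [hB]; exact B_orth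
  refine ⟨A_orth, B_orth, ?_, ?_⟩
  · rw [Subgroup.closure_le]
    rintro x (rfl | rfl)
    exacts [hAO, hBO]
  · set Γ := (Subgroup.closure {A, B}).subgroupOf (orthogonalSubgroup matQ) with hΓ
    have hA' : (⟨A, hAO⟩ : orthogonalSubgroup matQ) ∈ Γ :=
      Subgroup.subset_closure (Set.mem_insert _ _)
    have hB' : (⟨B, hBO⟩ : orthogonalSubgroup matQ) ∈ Γ :=
      Subgroup.subset_closure (Set.mem_insert_of_mem _ rfl)
    have hN := level_GL (Γ.map phi) (phi ⟨A, hAO⟩) (phi ⟨B, hBO⟩)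
      (Subgroup.mem_map_of_mem _ hA') (Subgroup.mem_map_of_mem _ hB')
      (P_cancel (by rw [phi_val, P_phiM _ hAO, hA, A_P]))
      (P_cancel (by rw [phi_val, P_phiM _ hBO, hB, B_P]))
    have h1 := trel_GL.relIndex (6912*6912*6912) (by norm_num)
    have h2 := Subgroup.relIndex_ne_zero_trans h1 HH_relIndex
    have h3 : (Γ.map phi).relIndex phi.range ≠ 0 := fun h0 =>
      h2 (Subgroup.relIndex_eq_zero_of_le_left hN
        (Subgroup.relIndex_eq_zero_of_le_right phi_range h0))
    rw [← Subgroup.index_comap, Subgroup.comap_map_eq_self_of_injective phi_injective] at h3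
    exact ⟨h3⟩
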